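/- There exists an invariant probability measure μ^N for the silo process W_t on [0,∞)^{Λ^N}, and the mean weights under μ^N are finite and given by ∫ W(i) dμ^N(W) = i(N+1−i) for every i ∈ Λ^N. -/

import Mathlib

open MeasureTheory ProbabilityTheory Filter

noncomputable section

/-- The uniform distribution on `[0,1]`. -/
def unif01 : Measure ℝ := volume.restrict (Set.Icc (0:ℝ) 1)

/-- Truncation of a configuration to the box `Λ^N = {1,…,N}` (zero outside). -/
def trunc (N : ℕ) (w : ℤ → ℝ) : ℤ → ℝ :=
  fun i => if 1 ≤ i ∧ i ≤ (N : ℤ) then w i else 0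

/-- One step of the width-`N` silo dynamics with fractions `u` and added weights `v`. -/
def siloStep (N : ℕ) (u v w : ℤ → ℝ) : ℤ → ℝ :=
  trunc N fun i => v i + trunc N w (i + 1) * u (i + 1) + trunc N w (i - 1) * (1 - u (i - 1))

/-- `ν` is the product measure on `ℤ → ℝ` with all marginals `m`
(characterized through its finite-dimensional distributions). -/
def IsProductLaw (m : Measure ℝ) (ν : Measure (ℤ → ℝ)) : Prop :=
  IsProbabilityMeasure ν ∧
    ∀ I : Finset ℤ, ν.map (fun w (i : I) => w (i : ℤ)) = Measure.pi fun _ : I => m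

/-- The law on `ℤ → ℝ` which is iid `m` on the finite window `I` and `0` elsewhere. -/
def finExtLaw (I : Finset ℤ) (m : Measure ℝ) : Measure (ℤ → ℝ) :=
  (Measure.pi fun _ : I => m).map fun f i => if h : i ∈ I then f ⟨i, h⟩ else 0

/-- Law of the pair (fractions, weights) driving one step of the width-`N` silo. -/
def siloDriveLaw (N : ℕ) (νV : Measure ℝ) : Measure ((ℤ → ℝ) × (ℤ → ℝ)) :=
  (finExtLaw (Finset.Icc 0 ((N : ℤ) + 1)) unif01).prod (finExtLaw (Finset.Icc 1 (N : ℤ)) νV)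

/-- `μ` is carried by the state space `[0,∞)^{Λ^N}`. -/
def SiloSupported (N : ℕ) (μ : Measure (ℤ → ℝ)) : Prop :=
  μ {w | ∀ i : ℤ, 0 ≤ w i ∧ (¬(1 ≤ i ∧ i ≤ (N : ℤ)) → w i = 0)} = 1

/-- Hypotheses on the common law of the grain weights `V_t(i)`: a probability measure on
`[0,∞)` with mean `1` and finite variance. -/
def IsVLaw (νV : Measure ℝ) : Prop :=
  IsProbabilityMeasure νV ∧ νV {x | x < 0} = 0 ∧ (∫ x, x ∂νV) = 1 ∧
    Integrable (fun x => x ^ 2) νV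

/-- `μ` is an invariant probability measure for the width-`N` silo process. -/
def IsSiloInvariant (N : ℕ) (νV : Measure ℝ) (μ : Measure (ℤ → ℝ)) : Prop :=
  IsProbabilityMeasure μ ∧ SiloSupported N μ ∧
    (μ.prod (siloDriveLaw N νV)).map (fun p => siloStep N p.2.1 p.2.2 p.1) = μ

/-- The law of the silo process at time `t`, started from the distribution `μ0`. -/
def siloChainLaw (N : ℕ) (νV : Measure ℝ) (μ0 : Measure (ℤ → ℝ)) : ℕ → Measure (ℤ → ℝ)
  | 0 => μ0
  | t + 1 =>
      ((siloChainLaw N νV μ0 t).prod (siloDriveLaw N νV)).map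
        fun p => siloStep N p.2.1 p.2.2 p.1

/-- One step of the infinite silo model with fractions `u`. -/
def ismStep (u η : ℤ → ℝ) : ℤ → ℝ :=
  fun i => η (i - 1) * u (i - 1) + η (i + 1) * (1 - u (i + 1))

/-- `ν` is invariant for the infinite silo model. -/
def IsISMInvariant (ν : Measure (ℤ → ℝ)) : Prop :=
  ∀ κ : Measure (ℤ → ℝ), IsProductLaw unif01 κ →
    ((ν.prod κ).map fun p => ismStep p.2 p.1) = ν

/-- The shift `τ_1` on configurations. -/
def shift1 (η : ℤ → ℝ) : ℤ → ℝ := fun i => η (i - 1)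

/-- `ν` plays the role of `ν_ρ`: the product of Gamma(2, 2/ρ) laws for `ρ ≠ 0`,
and the point mass at the zero configuration for `ρ = 0`. -/
def IsNuRho (ρ : ℝ) (ν : Measure (ℤ → ℝ)) : Prop :=
  (ρ = 0 → ν = Measure.dirac fun _ => 0) ∧
    (ρ ≠ 0 → IsProductLaw (gammaMeasure 2 (2 / ρ)) ν)


section FinExtLaw

theorem measurable_extend_zero (I : Finset ℤ) :
    Measurable fun (f : I → ℝ) (i : ℤ) => if h : i ∈ I then f ⟨i, h⟩ else 0 := by
  refine measurable_pi_iff.2 fun i => ?_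
  by_cases h : i ∈ I
  · simpa [h] using measurable_pi_apply _
  · simp [h]

instance isProbabilityMeasure_unif01 : IsProbabilityMeasure unif01 :=
  ⟨by simp [unif01]⟩

instance isProbabilityMeasure_finExtLaw (I : Finset ℤ) (m : Measure ℝ) [IsProbabilityMeasure m] :
    IsProbabilityMeasure (finExtLaw I m) :=
  Measure.isProbabilityMeasure_map (measurable_extend_zero I).aemeasurable

instance isProbabilityMeasure_siloDriveLaw (N : ℕ) (m : Measure ℝ) [IsProbabilityMeasure m] :
    IsProbabilityMeasure (siloDriveLaw N m) := by
  unfold siloDriveLaw; infer_instance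

theorem measurePreserving_eval_finExtLaw {I : Finset ℤ} (m : Measure ℝ) [IsProbabilityMeasure m]
    {i : ℤ} (hi : i ∈ I) : MeasurePreserving (fun w : ℤ → ℝ => w i) (finExtLaw I m) m := by
  refine ⟨measurable_pi_apply i, ?_⟩
  rw [finExtLaw, Measure.map_map (measurable_pi_apply i) (measurable_extend_zero I)]
  have := (measurePreserving_eval (fun _ : I => m) ⟨i, hi⟩).map_eq
  convert this using 2
  ext f
  simp [hi]

theorem ae_finExtLaw {I : Finset ℤ} {m : Measure ℝ} [IsProbabilityMeasure m] {p : ℝ → Prop}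
    (h0 : p 0) (hp : ∀ᵐ x ∂m, p x) : ∀ᵐ w ∂finExtLaw I m, ∀ i, p (w i) := by
  refine ae_all_iff.2 fun i => ?_
  by_cases hi : i ∈ I
  · exact (measurePreserving_eval_finExtLaw m hi).quasiMeasurePreserving.ae hp
  · refine ae_of_ae_map (f := fun w : ℤ → ℝ => w i) (p := p) (measurable_pi_apply i).aemeasurable ?_
    rw [finExtLaw, Measure.map_map (measurable_pi_apply i) (measurable_extend_zero I)]
    have : (fun w : ℤ → ℝ => w i) ∘ (fun (f : I → ℝ) (i : ℤ) => if h : i ∈ I then f ⟨i, h⟩ else 0)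
        = fun _ => 0 := by
      ext f; simp [hi]
    rw [this, Measure.map_const]
    simp [h0, ae_dirac_eq]

end FinExtLaw

section Drive

variable {N : ℕ} {m : Measure ℝ}

/-- Admissible driving variables: fractions in `[0,1]` and nonnegative weights. -/
def IsAdmissible (d : (ℤ → ℝ) × (ℤ → ℝ)) : Prop :=
  (∀ i, 0 ≤ d.1 i ∧ d.1 i ≤ 1) ∧ ∀ i, 0 ≤ d.2 i

theorem ae_isAdmissible (hm : IsVLaw m) : ∀ᵐ d ∂siloDriveLaw N m, IsAdmissible d := by
  have := hm.1
  have hu : ∀ᵐ x ∂unif01, 0 ≤ x ∧ x ≤ 1 := by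
    exact ae_restrict_mem measurableSet_Icc
  have hv : ∀ᵐ x ∂m, 0 ≤ x := by
    rw [ae_iff]; simpa using hm.2.1
  have h1 := ae_finExtLaw (I := Finset.Icc 0 ((N : ℤ) + 1)) (p := fun x => 0 ≤ x ∧ x ≤ 1)
    (by norm_num) hu
  have h2 := ae_finExtLaw (I := Finset.Icc 1 (N : ℤ)) le_rfl hv
  exact (Measure.quasiMeasurePreserving_fst.ae h1).and (Measure.quasiMeasurePreserving_snd.ae h2)

theorem IsVLaw.integrable (hm : IsVLaw m) : Integrable (fun x : ℝ => x) m := by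
  by_contra h
  simpa [integral_undef h] using hm.2.2.1

theorem integrable_id_unif01 : Integrable (fun x : ℝ => x) unif01 :=
  continuous_id.integrableOn_Icc

theorem integral_id_unif01 : ∫ x, x ∂unif01 = 1 / 2 := by
  rw [unif01, integral_Icc_eq_integral_Ioc, ← intervalIntegral.integral_of_le zero_le_one]
  simp

theorem measurePreserving_fraction [IsProbabilityMeasure m] {i : ℤ} (h0 : 0 ≤ i)
    (h1 : i ≤ (N : ℤ) + 1) :
    MeasurePreserving (fun d : (ℤ → ℝ) × (ℤ → ℝ) => d.1 i) (siloDriveLaw N m) unif01 :=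
  (measurePreserving_eval_finExtLaw unif01 (Finset.mem_Icc.2 ⟨h0, h1⟩)).comp
    measurePreserving_fst

theorem measurePreserving_weight [IsProbabilityMeasure m] {i : ℤ} (h0 : 1 ≤ i)
    (h1 : i ≤ (N : ℤ)) :
    MeasurePreserving (fun d : (ℤ → ℝ) × (ℤ → ℝ) => d.2 i) (siloDriveLaw N m) m :=
  (measurePreserving_eval_finExtLaw m (Finset.mem_Icc.2 ⟨h0, h1⟩)).comp
    measurePreserving_snd

end Drive

section Step

variable {N : ℕ}

theorem trunc_of_mem {w : ℤ → ℝ} {i : ℤ} (h0 : 1 ≤ i) (h1 : i ≤ (N : ℤ)) : trunc N w i = w i :=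
  if_pos ⟨h0, h1⟩

theorem trunc_of_notMem {w : ℤ → ℝ} {i : ℤ} (h : ¬(1 ≤ i ∧ i ≤ (N : ℤ))) : trunc N w i = 0 :=
  if_neg h

theorem trunc_mono {w w' : ℤ → ℝ} (h : ∀ i, w i ≤ w' i) (i : ℤ) : trunc N w i ≤ trunc N w' i := by
  unfold trunc
  split_ifs
  exacts [h i, le_rfl]

theorem trunc_nonneg {w : ℤ → ℝ} (h : ∀ i, 0 ≤ w i) (i : ℤ) : 0 ≤ trunc N w i := by
  unfold trunc
  split_ifs
  exacts [h i, le_rfl]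

theorem siloStep_nonneg {d : (ℤ → ℝ) × (ℤ → ℝ)} (hd : IsAdmissible d) {w : ℤ → ℝ}
    (hw : ∀ i, 0 ≤ w i) (i : ℤ) : 0 ≤ siloStep N d.1 d.2 w i :=
  trunc_nonneg (fun _ => add_nonneg (add_nonneg (hd.2 _)
    (mul_nonneg (trunc_nonneg hw _) (hd.1 _).1))
    (mul_nonneg (trunc_nonneg hw _) (sub_nonneg.2 (hd.1 _).2))) i

theorem siloStep_mono {d : (ℤ → ℝ) × (ℤ → ℝ)} (hd : IsAdmissible d) {w w' : ℤ → ℝ}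
    (h : ∀ i, w i ≤ w' i) (i : ℤ) : siloStep N d.1 d.2 w i ≤ siloStep N d.1 d.2 w' i :=
  trunc_mono (fun _ => add_le_add (add_le_add le_rfl
    (mul_le_mul_of_nonneg_right (trunc_mono h _) (hd.1 _).1))
    (mul_le_mul_of_nonneg_right (trunc_mono h _) (sub_nonneg.2 (hd.1 _).2))) i

theorem tendsto_trunc {W : ℕ → ℤ → ℝ} {w : ℤ → ℝ}
    (h : ∀ i, Tendsto (fun n => W n i) atTop (nhds (w i))) (i : ℤ) :
    Tendsto (fun n => trunc N (W n) i) atTop (nhds (trunc N w i)) := by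
  unfold trunc
  split_ifs
  exacts [h i, tendsto_const_nhds]

theorem tendsto_siloStep {W : ℕ → ℤ → ℝ} {w : ℤ → ℝ} (u v : ℤ → ℝ)
    (h : ∀ i, Tendsto (fun n => W n i) atTop (nhds (w i))) (i : ℤ) :
    Tendsto (fun n => siloStep N u v (W n) i) atTop (nhds (siloStep N u v w i)) :=
  tendsto_trunc (fun _ => (tendsto_const_nhds.add ((tendsto_trunc h _).mul_const _)).add
    ((tendsto_trunc h _).mul_const _)) i

theorem measurable_trunc : Measurable (trunc N) := by
  refine measurable_pi_iff.2 fun i => ?_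
  unfold trunc
  split_ifs <;> fun_prop

theorem measurable_siloStep :
    Measurable fun p : ((ℤ → ℝ) × (ℤ → ℝ)) × (ℤ → ℝ) => siloStep N p.1.1 p.1.2 p.2 := by
  have ht : ∀ i, Measurable fun w : ℤ → ℝ => trunc N w i :=
    fun i => measurable_pi_iff.1 measurable_trunc i
  refine measurable_trunc.comp (measurable_pi_iff.2 fun i => ?_)
  exact ((by fun_prop : Measurable fun p : ((ℤ → ℝ) × (ℤ → ℝ)) × (ℤ → ℝ) => p.1.2 i).add
    (((ht _).comp measurable_snd).mul (by fun_prop))).add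
    (((ht _).comp measurable_snd).mul (by fun_prop))

/-- The mean weights after one step, in terms of the mean weights before. -/
theorem integrable_siloStep_and_integral {Ω : Type*} [MeasurableSpace Ω] {P : Measure Ω}
    [IsProbabilityMeasure P] {m : Measure ℝ} (hm : IsVLaw m) {X : Ω → ℤ → ℝ}
    (hX : ∀ i, Integrable (fun ω => X ω i) P) {i : ℤ} (h1 : 1 ≤ i) (h2 : i ≤ (N : ℤ)) :
    Integrable (fun p : ((ℤ → ℝ) × (ℤ → ℝ)) × Ω => siloStep N p.1.1 p.1.2 (X p.2) i)
        ((siloDriveLaw N m).prod P) ∧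
      ∫ p : ((ℤ → ℝ) × (ℤ → ℝ)) × Ω, siloStep N p.1.1 p.1.2 (X p.2) i
          ∂((siloDriveLaw N m).prod P)
        = 1 + ((∫ ω, trunc N (X ω) (i + 1) ∂P) + ∫ ω, trunc N (X ω) (i - 1) ∂P) / 2 := by
  have := hm.1
  have hT : ∀ j, Integrable (fun ω => trunc N (X ω) j) P := by
    intro j
    unfold trunc
    split_ifs
    exacts [hX j, integrable_zero _ _ _]
  have hv := measurePreserving_weight (m := m) h1 h2
  have hu := measurePreserving_fraction (N := N) (m := m) (i := i + 1) (by omega) (by omega)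
  have hu' := measurePreserving_fraction (N := N) (m := m) (i := i - 1) (by omega) (by omega)
  have Iv : Integrable (fun d : (ℤ → ℝ) × (ℤ → ℝ) => d.2 i) (siloDriveLaw N m) :=
    hv.integrable_comp_of_integrable hm.integrable
  have Iu : Integrable (fun d : (ℤ → ℝ) × (ℤ → ℝ) => d.1 (i + 1)) (siloDriveLaw N m) :=
    hu.integrable_comp_of_integrable integrable_id_unif01
  have Iu' : Integrable (fun d : (ℤ → ℝ) × (ℤ → ℝ) => d.1 (i - 1)) (siloDriveLaw N m) :=
    hu'.integrable_comp_of_integrable integrable_id_unif01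
  have Ev : ∫ d : (ℤ → ℝ) × (ℤ → ℝ), d.2 i ∂siloDriveLaw N m = 1 := by
    rw [← integral_map (f := fun x : ℝ => x) hv.aemeasurable (by fun_prop), hv.map_eq, hm.2.2.1]
  have Eu : ∫ d : (ℤ → ℝ) × (ℤ → ℝ), d.1 (i + 1) ∂siloDriveLaw N m = 1 / 2 := by
    rw [← integral_map (f := fun x : ℝ => x) hu.aemeasurable (by fun_prop), hu.map_eq,
      integral_id_unif01]
  have Eu' : ∫ d : (ℤ → ℝ) × (ℤ → ℝ), d.1 (i - 1) ∂siloDriveLaw N m = 1 / 2 := by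
    rw [← integral_map (f := fun x : ℝ => x) hu'.aemeasurable (by fun_prop), hu'.map_eq,
      integral_id_unif01]
  have Iu1 : Integrable (fun d : (ℤ → ℝ) × (ℤ → ℝ) => 1 - d.1 (i - 1)) (siloDriveLaw N m) :=
    (integrable_const 1).sub Iu'
  have A : Integrable (fun p : ((ℤ → ℝ) × (ℤ → ℝ)) × Ω => p.1.2 i)
    ((siloDriveLaw N m).prod P) := Iv.comp_fst P
  have B := Iu.mul_prod (hT (i + 1))
  have C := Iu1.mul_prod (hT (i - 1))
  have key : (fun p : ((ℤ → ℝ) × (ℤ → ℝ)) × Ω => siloStep N p.1.1 p.1.2 (X p.2) i) =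
      fun p => p.1.2 i + p.1.1 (i + 1) * trunc N (X p.2) (i + 1) +
        (1 - p.1.1 (i - 1)) * trunc N (X p.2) (i - 1) := by
    ext p
    rw [siloStep, trunc_of_mem h1 h2]
    ring
  rw [key]
  refine ⟨(A.add B).add C, ?_⟩
  have EA : ∫ p : ((ℤ → ℝ) × (ℤ → ℝ)) × Ω, p.1.2 i ∂((siloDriveLaw N m).prod P) = 1 := by
    rw [integral_fun_fst (fun d : (ℤ → ℝ) × (ℤ → ℝ) => d.2 i), Ev]
    simp
  have EB := integral_prod_mul (μ := siloDriveLaw N m) (ν := P)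
    (fun d : (ℤ → ℝ) × (ℤ → ℝ) => d.1 (i + 1)) (fun ω => trunc N (X ω) (i + 1))
  have EC := integral_prod_mul (μ := siloDriveLaw N m) (ν := P)
    (fun d : (ℤ → ℝ) × (ℤ → ℝ) => 1 - d.1 (i - 1)) (fun ω => trunc N (X ω) (i - 1))
  have E1 : ∫ d : (ℤ → ℝ) × (ℤ → ℝ), (1 - d.1 (i - 1)) ∂siloDriveLaw N m = 1 / 2 := by
    rw [integral_sub (integrable_const _) Iu', Eu']
    norm_num
  rw [integral_add (by exact A.add B) C, integral_add A B, EA, EB, EC, Eu, E1]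
  ring

end Step

section Stream

variable {D : Type*} [MeasurableSpace D]

/-- Prepend an element to a sequence. -/
def streamCons (p : D × (ℕ → D)) : ℕ → D
  | 0 => p.1
  | n + 1 => p.2 n

theorem measurable_streamCons : Measurable (streamCons : D × (ℕ → D) → ℕ → D) := by
  refine measurable_pi_iff.2 fun n => ?_
  cases n with
  | zero => exact measurable_fst
  | succ n => exact (measurable_pi_apply n).comp measurable_snd

theorem measurePreserving_streamCons (κ : Measure D) [IsProbabilityMeasure κ] :
    MeasurePreserving (streamCons : D × (ℕ → D) → ℕ → D)
      (κ.prod (Measure.infinitePi fun _ => κ)) (Measure.infinitePi fun _ => κ) := by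
  classical
  refine ⟨measurable_streamCons, Measure.eq_infinitePi _ fun s t ht => ?_⟩
  obtain ⟨n, hn⟩ := s.exists_nat_subset_range
  set t' : ℕ → Set D := fun i => if i ∈ s then t i else Set.univ with ht'_def
  have ht' : ∀ i, MeasurableSet (t' i) := by
    intro i
    simp only [ht'_def]
    split_ifs
    exacts [ht i, .univ]
  have hpre : streamCons ⁻¹' (Set.pi (s : Set ℕ) t) =
      t' 0 ×ˢ Set.pi ((Finset.range n : Finset ℕ) : Set ℕ) (fun i => t' (i + 1)) := by
    ext p
    simp only [Set.mem_preimage, Set.mem_pi, Finset.mem_coe, Set.mem_prod, ht'_def]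
    constructor
    · intro h
      refine ⟨?_, fun i _ => ?_⟩
      · split_ifs with h0
        exacts [h 0 h0, trivial]
      · split_ifs with h0
        exacts [h (i + 1) h0, trivial]
    · rintro ⟨h0, h1⟩ i hi
      cases i with
      | zero => simpa [hi, streamCons] using h0
      | succ i =>
        have hi' := Finset.mem_range.1 (hn hi)
        simpa [hi, streamCons] using h1 i (Finset.mem_range.2 (by omega))
  rw [Measure.map_apply measurable_streamCons
    (MeasurableSet.pi s.countable_toSet fun i _ => ht i), hpre, Measure.prod_prod,
    Measure.infinitePi_pi _ fun i _ => ht' (i + 1), mul_comm,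
    ← Finset.prod_range_succ' (fun i => κ (t' i))]
  rw [← Finset.prod_subset (hn.trans (Finset.range_subset_range.2 n.le_succ))]
  · exact Finset.prod_congr rfl fun i hi => by simp [ht'_def, hi]
  · intro i _ hi
    simp [ht'_def, hi]

end Stream

section MonotoneLimit

variable {Ω : Type*} [MeasurableSpace Ω] {P : Measure Ω}

/-- An a.e. monotone sequence of nonnegative functions with bounded integrals converges a.e.
to an integrable function. -/
theorem ae_tendsto_and_integrable_of_monotone [IsProbabilityMeasure P] {f : ℕ → Ω → ℝ}
    (hf : ∀ n, Measurable (f n)) (hint : ∀ n, Integrable (f n) P)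
    (h0 : ∀ᵐ ω ∂P, ∀ n, 0 ≤ f n ω) (hmono : ∀ᵐ ω ∂P, Monotone fun n => f n ω) {C : ℝ}
    (hC : ∀ n, ∫ ω, f n ω ∂P ≤ C) :
    (∀ᵐ ω ∂P, Tendsto (fun n => f n ω) atTop (nhds (⨆ n, ENNReal.ofReal (f n ω)).toReal)) ∧
      Integrable (fun ω => (⨆ n, ENNReal.ofReal (f n ω)).toReal) P := by
  have hmeas : Measurable fun ω => ⨆ n, ENNReal.ofReal (f n ω) :=
    Measurable.iSup fun n => (hf n).ennreal_ofReal
  have hfin : ∫⁻ ω, ⨆ n, ENNReal.ofReal (f n ω) ∂P ≠ ⊤ := by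
    rw [lintegral_iSup' (fun n => (hf n).ennreal_ofReal.aemeasurable)
      (hmono.mono fun ω h a b hab => ENNReal.ofReal_le_ofReal (h hab))]
    refine ne_top_of_le_ne_top (ENNReal.ofReal_ne_top (r := C)) (iSup_le fun n => ?_)
    rw [← ofReal_integral_eq_lintegral_ofReal (hint n) (h0.mono fun ω h => h n)]
    exact ENNReal.ofReal_le_ofReal (hC n)
  refine ⟨?_, integrable_toReal_of_lintegral_ne_top hmeas.aemeasurable hfin⟩
  filter_upwards [ae_lt_top hmeas hfin, h0, hmono] with ω h1 h2 h3
  have h4 := (ENNReal.tendsto_toReal h1.ne).comp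
    (tendsto_atTop_iSup fun a b hab => ENNReal.ofReal_le_ofReal (h3 hab))
  refine h4.congr fun n => ?_
  simp [ENNReal.toReal_ofReal (h2 n)]

end MonotoneLimit

section Backward

/-- Backward iteration of the silo dynamics from the empty configuration. -/
def siloBackward (N : ℕ) : ℕ → (ℕ → (ℤ → ℝ) × (ℤ → ℝ)) → ℤ → ℝ
  | 0, _ => 0
  | n + 1, ω => siloStep N (ω 0).1 (ω 0).2 (siloBackward N n fun k => ω (k + 1))

/-- The limit of the backward iteration. -/
def siloLimit (N : ℕ) (ω : ℕ → (ℤ → ℝ) × (ℤ → ℝ)) (i : ℤ) : ℝ :=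
  (⨆ n, ENNReal.ofReal (siloBackward N n ω i)).toReal

variable {N : ℕ} {m : Measure ℝ}

theorem siloBackward_of_notMem {i : ℤ} (hi : ¬(1 ≤ i ∧ i ≤ (N : ℤ))) (n : ℕ)
    (ω : ℕ → (ℤ → ℝ) × (ℤ → ℝ)) : siloBackward N n ω i = 0 := by
  cases n with
  | zero => rfl
  | succ n => rw [siloBackward, siloStep, trunc_of_notMem hi]

theorem measurable_siloBackward (n : ℕ) : Measurable (siloBackward N n) := by
  induction n with
  | zero => exact measurable_const
  | succ n ih =>
    have hshift : Measurable fun (ω : ℕ → (ℤ → ℝ) × (ℤ → ℝ)) (k : ℕ) => ω (k + 1) :=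
      measurable_pi_iff.2 fun k => measurable_pi_apply (k + 1)
    exact measurable_siloStep.comp
      ((measurable_pi_apply (X := fun _ : ℕ => (ℤ → ℝ) × (ℤ → ℝ)) 0).prodMk (ih.comp hshift))

theorem measurable_siloLimit : Measurable (siloLimit N) :=
  measurable_pi_iff.2 fun i => (Measurable.iSup fun n =>
    (measurable_pi_iff.1 (measurable_siloBackward n) i).ennreal_ofReal).ennreal_toReal

theorem siloBackward_nonneg {n : ℕ} {ω : ℕ → (ℤ → ℝ) × (ℤ → ℝ)} (hω : ∀ k, IsAdmissible (ω k))
    (i : ℤ) : 0 ≤ siloBackward N n ω i := by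
  induction n generalizing ω i with
  | zero => exact le_rfl
  | succ n ih => exact siloStep_nonneg (hω 0) (fun j => ih (fun k => hω (k + 1)) j) i

theorem siloBackward_le_succ {n : ℕ} {ω : ℕ → (ℤ → ℝ) × (ℤ → ℝ)} (hω : ∀ k, IsAdmissible (ω k))
    (i : ℤ) : siloBackward N n ω i ≤ siloBackward N (n + 1) ω i := by
  induction n generalizing ω i with
  | zero => exact siloBackward_nonneg (n := 1) hω i
  | succ n ih => exact siloStep_mono (hω 0) (fun j => ih (fun k => hω (k + 1)) j) i

theorem ae_forall_isAdmissible (hm : IsVLaw m) :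
    ∀ᵐ ω ∂Measure.infinitePi fun _ : ℕ => siloDriveLaw N m, ∀ k, IsAdmissible (ω k) := by
  have := hm.1
  exact ae_all_iff.2 fun k => (measurePreserving_eval_infinitePi
    (fun _ : ℕ => siloDriveLaw N m) k).quasiMeasurePreserving.ae (ae_isAdmissible hm)

theorem integral_trunc_le {Ω : Type*} [MeasurableSpace Ω] {P : Measure Ω} {X : Ω → ℤ → ℝ}
    (h : ∀ i : ℤ, 1 ≤ i → i ≤ (N : ℤ) → ∫ ω, X ω i ∂P ≤ (i : ℝ) * ((N : ℝ) + 1 - i))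
    {i : ℤ} (h0 : 0 ≤ i) (h1 : i ≤ (N : ℤ) + 1) :
    ∫ ω, trunc N (X ω) i ∂P ≤ (i : ℝ) * ((N : ℝ) + 1 - i) := by
  by_cases hi : 1 ≤ i ∧ i ≤ (N : ℤ)
  · simpa [trunc, hi] using h i hi.1 hi.2
  · have e1 : (0 : ℝ) ≤ i := by exact_mod_cast h0
    have e2 : (i : ℝ) ≤ (N : ℝ) + 1 := by exact_mod_cast h1
    simpa [trunc, hi] using mul_nonneg e1 (sub_nonneg.2 e2)

theorem integrable_siloBackward_and_integral_le (hm : IsVLaw m) (n : ℕ) :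
    (∀ i, Integrable (fun ω => siloBackward N n ω i)
        (Measure.infinitePi fun _ : ℕ => siloDriveLaw N m)) ∧
      ∀ i : ℤ, 1 ≤ i → i ≤ (N : ℤ) →
        ∫ ω, siloBackward N n ω i ∂(Measure.infinitePi fun _ : ℕ => siloDriveLaw N m)
          ≤ (i : ℝ) * ((N : ℝ) + 1 - i) := by
  have := hm.1
  have hc := measurePreserving_streamCons (siloDriveLaw N m)
  have hB : ∀ n i, Measurable fun ω => siloBackward N n ω i :=
    fun n i => measurable_pi_iff.1 (measurable_siloBackward n) i
  induction n with
  | zero =>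
    refine ⟨fun i => integrable_zero _ _ _, fun i h1 h2 => ?_⟩
    have e1 : (1 : ℝ) ≤ i := by exact_mod_cast h1
    have e2 : (i : ℝ) ≤ N := by exact_mod_cast h2
    have : 0 ≤ (i : ℝ) * ((N : ℝ) + 1 - i) := mul_nonneg (by linarith) (by linarith)
    simpa [siloBackward] using this
  | succ n ih =>
    refine ⟨fun i => ?_, fun i h1 h2 => ?_⟩
    · by_cases hi : 1 ≤ i ∧ i ≤ (N : ℤ)
      · rw [← hc.map_eq, integrable_map_measure (hB _ i).aestronglyMeasurable hc.aemeasurable]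
        exact (integrable_siloStep_and_integral hm ih.1 hi.1 hi.2).1
      · simp [siloBackward_of_notMem hi]
    · have key := (integrable_siloStep_and_integral hm ih.1 h1 h2).2
      have a := integral_trunc_le ih.2 (i := i + 1) (by omega) (by omega)
      have b := integral_trunc_le ih.2 (i := i - 1) (by omega) (by omega)
      conv_lhs => rw [← hc.map_eq]
      rw [integral_map hc.aemeasurable (hB _ i).aestronglyMeasurable]
      refine (key.trans_le ?_ :)
      push_cast at a b
      linarith

theorem ae_tendsto_siloBackward (hm : IsVLaw m) (i : ℤ) :
    (∀ᵐ ω ∂Measure.infinitePi fun _ : ℕ => siloDriveLaw N m,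
        Tendsto (fun n => siloBackward N n ω i) atTop (nhds (siloLimit N ω i))) ∧
      Integrable (fun ω => siloLimit N ω i)
        (Measure.infinitePi fun _ : ℕ => siloDriveLaw N m) := by
  have := hm.1
  by_cases hi : 1 ≤ i ∧ i ≤ (N : ℤ)
  · exact ae_tendsto_and_integrable_of_monotone
      (fun n => measurable_pi_iff.1 (measurable_siloBackward n) i)
      (fun n => (integrable_siloBackward_and_integral_le hm n).1 i)
      ((ae_forall_isAdmissible hm).mono fun ω h n => siloBackward_nonneg h i)
      ((ae_forall_isAdmissible hm).mono fun ω h =>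
        monotone_nat_of_le_succ fun n => siloBackward_le_succ h i)
      (fun n => (integrable_siloBackward_and_integral_le hm n).2 i hi.1 hi.2)
  · simp [siloLimit, siloBackward_of_notMem hi]

/-- The limit of the backward iteration solves the distributional fixed-point equation. -/
theorem siloLimit_streamCons (hm : IsVLaw m) :
    ∀ᵐ p ∂(siloDriveLaw N m).prod (Measure.infinitePi fun _ : ℕ => siloDriveLaw N m),
      siloLimit N (streamCons p) = siloStep N p.1.1 p.1.2 (siloLimit N p.2) := by
  have := hm.1
  have h := ae_all_iff.2 fun i => (ae_tendsto_siloBackward (N := N) hm i).1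
  filter_upwards [(measurePreserving_streamCons (siloDriveLaw N m)).quasiMeasurePreserving.ae h,
    Measure.quasiMeasurePreserving_snd.ae h] with p h1 h2
  ext i
  exact tendsto_nhds_unique ((tendsto_add_atTop_iff_nat 1).2 (h1 i))
    (tendsto_siloStep p.1.1 p.1.2 h2 i)

end Backward

/-- Uniqueness for the discrete Dirichlet problem satisfied by the mean weights. -/
theorem eq_of_discrete_poisson {N : ℕ} {M : ℤ → ℝ} (h0 : M 0 = 0) (hN : M ((N : ℤ) + 1) = 0)
    (h : ∀ i : ℤ, 1 ≤ i → i ≤ (N : ℤ) → M i = 1 + (M (i + 1) + M (i - 1)) / 2)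
    {i : ℤ} (h1 : 0 ≤ i) (h2 : i ≤ (N : ℤ) + 1) : M i = (i : ℝ) * ((N : ℝ) + 1 - i) := by
  have key : ∀ k : ℕ, k ≤ N →
      M k = k * (M 1 + 1 - k) ∧ M ((k : ℤ) + 1) = (k + 1) * (M 1 - k) := by
    intro k
    induction k with
    | zero => intro _; simp [h0]
    | succ k ih =>
      intro hk
      obtain ⟨a, b⟩ := ih (by omega)
      have c := h (k + 1) (by omega) (by omega)
      rw [add_sub_cancel_right] at c
      push_cast
      refine ⟨by rw [b]; ring, ?_⟩
      linarith
  have hM : M 1 = N := by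
    have := (key N le_rfl).2
    rw [hN] at this
    have hpos : (0 : ℝ) < N + 1 := by positivity
    rcases mul_eq_zero.1 this.symm with h | h <;> linarith
  lift i to ℕ using h1
  rcases Nat.lt_or_ge N i with hi | hi
  · have : (i : ℤ) = (N : ℤ) + 1 := by omega
    rw [this, hN]
    push_cast
    ring
  · rw [(key i hi).1, hM]
    push_cast
    ring

/-- There exists an invariant probability measure `μ^N` for the width-`N` silo process,
and under it the mean weight at each site `i ∈ Λ^N` is finite and equals `i (N+1-i)`. -/
theorem silo_invariant_measure_exists (N : ℕ) (hN : 1 ≤ N)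
    (νV : Measure ℝ) (hνV : IsVLaw νV) :
    ∃ μ : Measure (ℤ → ℝ), IsSiloInvariant N νV μ ∧
      ∀ i : ℤ, 1 ≤ i → i ≤ (N : ℤ) →
        Integrable (fun w : ℤ → ℝ => w i) μ ∧
          (∫ w : ℤ → ℝ, w i ∂μ) = (i : ℝ) * ((N : ℝ) + 1 - (i : ℝ)) := by
  have := hνV.1
  set κ := siloDriveLaw N νV with hκ
  set P := Measure.infinitePi fun _ : ℕ => κ with hP
  have hc : MeasurePreserving streamCons (κ.prod P) P := measurePreserving_streamCons κ
  have hL : Measurable (siloLimit N) := measurable_siloLimit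
  have hLi : ∀ i, Measurable fun ω => siloLimit N ω i := fun i => measurable_pi_iff.1 hL i
  have hfix := siloLimit_streamCons (N := N) hνV
  have hint : ∀ i, Integrable (fun ω => siloLimit N ω i) P :=
    fun i => (ae_tendsto_siloBackward hνV i).2
  have hout : ∀ i, ¬(1 ≤ i ∧ i ≤ (N : ℤ)) → ∀ ω, siloLimit N ω i = 0 := fun i hi ω => by
    simp [siloLimit, siloBackward_of_notMem hi]
  have hprob : IsProbabilityMeasure (P.map (siloLimit N)) :=
    Measure.isProbabilityMeasure_map hL.aemeasurable
  refine ⟨P.map (siloLimit N), ⟨hprob, ?_, ?_⟩, fun i h1 h2 => ?_⟩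
  · have hmeas : MeasurableSet
        {w : ℤ → ℝ | ∀ i : ℤ, 0 ≤ w i ∧ (¬(1 ≤ i ∧ i ≤ (N : ℤ)) → w i = 0)} := by
      simp only [Set.ofPred_forall, Set.ofPred_and]
      exact MeasurableSet.iInter fun i =>
        (measurableSet_le measurable_const (measurable_pi_apply i)).inter
          (MeasurableSet.iInter fun _ =>
            measurableSet_eq_fun (measurable_pi_apply i) measurable_const)
    rw [SiloSupported, Measure.map_apply hL hmeas]
    have : siloLimit N ⁻¹'
        {w : ℤ → ℝ | ∀ i : ℤ, 0 ≤ w i ∧ (¬(1 ≤ i ∧ i ≤ (N : ℤ)) → w i = 0)} = Set.univ :=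
      Set.eq_univ_of_forall fun ω i => ⟨ENNReal.toReal_nonneg, fun hi => hout i hi ω⟩
    rw [this, measure_univ]
  · have hmap : κ.prod (P.map (siloLimit N)) = (κ.prod P).map (Prod.map id (siloLimit N)) := by
      rw [← Measure.map_prod_map _ _ measurable_id hL, Measure.map_id]
    have hstep := measurable_siloStep (N := N)
    have hswap : Measurable
        fun p : (ℤ → ℝ) × ((ℤ → ℝ) × (ℤ → ℝ)) => siloStep N p.2.1 p.2.2 p.1 :=
      hstep.comp measurable_swap
    rw [← Measure.prod_swap, Measure.map_map hswap measurable_swap, hmap,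
      Measure.map_map (hswap.comp measurable_swap) (measurable_id.prodMap hL)]
    conv_rhs => rw [← hc.map_eq, Measure.map_map hL measurable_streamCons]
    exact Measure.map_congr (hfix.mono fun p hp => hp.symm)
  · have hmean : ∀ j : ℤ, 1 ≤ j → j ≤ (N : ℤ) → ∫ ω, siloLimit N ω j ∂P =
        1 + ((∫ ω, siloLimit N ω (j + 1) ∂P) + ∫ ω, siloLimit N ω (j - 1) ∂P) / 2 := by
      intro j hj1 hj2
      have htr : ∀ ω, trunc N (siloLimit N ω) = siloLimit N ω := fun ω => by
        ext k
        by_cases hk : 1 ≤ k ∧ k ≤ (N : ℤ)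
        · exact trunc_of_mem hk.1 hk.2
        · rw [trunc_of_notMem hk, hout k hk]
      have key := (integrable_siloStep_and_integral hνV hint hj1 hj2).2
      simp only [htr] at key
      rw [← key]
      conv_lhs => rw [← hc.map_eq]
      rw [integral_map hc.aemeasurable (hLi j).aestronglyMeasurable]
      exact integral_congr_ae (hfix.mono fun p hp => congrFun hp j)
    have hmeas : Measurable fun w : ℤ → ℝ => w i := measurable_pi_apply i
    rw [integrable_map_measure hmeas.aestronglyMeasurable hL.aemeasurable,
      integral_map hL.aemeasurable hmeas.aestronglyMeasurable]
    exact ⟨hint i, eq_of_discrete_poisson (M := fun j => ∫ ω, siloLimit N ω j ∂P)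
      (by simp [hout 0 (by omega)]) (by simp [hout ((N : ℤ) + 1) (by omega)]) hmean
      (by omega) (by omega)⟩
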